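/- There is no 4×4 unitary complex matrix V, with columns indexed by Fin 2 × Fin 2, such that for every column v of V the matricization mat(v) is a positive semidefinite 2×2 matrix. Here each column of V is a vector in ℂ^(Fin 2 × Fin 2). -/

import Mathlib

open Matrix
open scoped ComplexOrder

noncomputable section

/-- The `mat` operator, inverse of `vec`: `(matM u) r c = u (c, r)`. -/
def matM {n : ℕ} (u : Fin n × Fin n → ℂ) : Matrix (Fin n) (Fin n) ℂ :=
  Matrix.of fun r c => u (c, r)

/-- The squared modulus of the off-diagonal entry of a positive semidefinite `2 × 2` matrix is at
most the product of the diagonal entries. -/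
theorem Matrix.PosSemidef.mul_star_le_diag_mul_diag {M : Matrix (Fin 2) (Fin 2) ℂ}
    (hM : M.PosSemidef) : M 1 0 * star (M 1 0) ≤ M 0 0 * M 1 1 := by
  have hdet := hM.det_nonneg
  rw [Matrix.det_fin_two, sub_nonneg] at hdet
  rwa [hM.isHermitian.apply 0 1, mul_comm]

/-- There is no `4 × 4` unitary complex matrix `V` (indexed by `Fin 2 × Fin 2`)
all of whose columns have positive semidefinite `2 × 2` matricizations. -/
theorem no_unitary_with_psd_columns :
    ¬ ∃ V : Matrix (Fin 2 × Fin 2) (Fin 2 × Fin 2) ℂ,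
        Vᴴ * V = 1 ∧
        ∀ c : Fin 2 × Fin 2, (matM (fun r => V r c)).PosSemidef := by
  rintro ⟨V, hV, hpsd⟩
  have hrows : V * Vᴴ = 1 := mul_eq_one_comm.mp hV
  have hdiag : ∑ c, V (0, 0) c * V (1, 1) c = 0 := by
    have h := congrFun (congrFun hrows (0, 0)) (1, 1)
    rw [Matrix.mul_apply, Matrix.one_apply_ne (by decide)] at h
    rw [← h]
    refine Finset.sum_congr rfl fun c _ => ?_
    exact congrArg (V (0, 0) c * ·) ((hpsd c).isHermitian.apply 1 1).symm
  have hoff : ∑ c, V (0, 1) c * star (V (0, 1) c) = 1 := by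
    have h := congrFun (congrFun hrows (0, 1)) (0, 1)
    rwa [Matrix.mul_apply, Matrix.one_apply_eq] at h
  have hle : ∑ c, V (0, 1) c * star (V (0, 1) c) ≤ ∑ c, V (0, 0) c * V (1, 1) c :=
    Finset.sum_le_sum fun c _ => (hpsd c).mul_star_le_diag_mul_diag
  rw [hoff, hdiag] at hle
  exact not_le_of_gt zero_lt_one hle
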